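/- Let (H, μ, Δ, α_H) be a Hom-bialgebra with α_H bijective, and let (M, α_M) and (N, α_N) be Yetter-Drinfeld modules over H. Then (M⊗N, α_M⊗α_N), equipped with the action h·(m⊗n) = α_H^{-2}(h₁)·m ⊗ α_H^{-2}(h₂)·n and the coaction m⊗n ↦ m_{(-1)}n_{(-1)} ⊗ (m_{(0)}⊗n_{(0)}), is a Yetter-Drinfeld module over H (denoted M⊗̃N); in particular it is a left H-module, a left H-comodule, and satisfies the Yetter-Drinfeld compatibility condition. -/

import Mathlib

open TensorProduct

noncomputable section

namespace HomYD

variable (k : Type*) [Field k]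
variable {H M N : Type*}
variable [AddCommGroup H] [Module k H]
variable [AddCommGroup M] [Module k M]
variable [AddCommGroup N] [Module k N]

/-- Rearrangement `(a ⊗ b) ⊗ c ↦ (a ⊗ c) ⊗ b`. -/
def rearr (A B C : Type*) [AddCommGroup A] [Module k A] [AddCommGroup B] [Module k B]
    [AddCommGroup C] [Module k C] :
    (A ⊗[k] B) ⊗[k] C →ₗ[k] (A ⊗[k] C) ⊗[k] B :=
  (TensorProduct.assoc k A C B).symm.toLinearMap ∘ₗ
    (TensorProduct.map LinearMap.id (TensorProduct.comm k B C).toLinearMap) ∘ₗ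
      (TensorProduct.assoc k A B C).toLinearMap

/-- Middle-four exchange `(a ⊗ b) ⊗ (c ⊗ d) ↦ (a ⊗ c) ⊗ (b ⊗ d)`. -/
def ttc (A B C D : Type*) [AddCommGroup A] [Module k A] [AddCommGroup B] [Module k B]
    [AddCommGroup C] [Module k C] [AddCommGroup D] [Module k D] :
    (A ⊗[k] B) ⊗[k] (C ⊗[k] D) →ₗ[k] (A ⊗[k] C) ⊗[k] (B ⊗[k] D) :=
  (TensorProduct.tensorTensorTensorComm k A B C D).toLinearMap

/-- Hom-bialgebra (no unit/counit): multiplicativity of `α`, Hom-associativity,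
comultiplicativity of `α`, Hom-coassociativity, and `Δ` multiplicative. -/
structure IsHomBialgebra (μ : H ⊗[k] H →ₗ[k] H) (Δ : H →ₗ[k] H ⊗[k] H)
    (α : H →ₗ[k] H) : Prop where
  mul_mult : ∀ a b : H, α (μ (a ⊗ₜ[k] b)) = μ (α a ⊗ₜ[k] α b)
  hom_assoc : ∀ a b c : H, μ (α a ⊗ₜ[k] μ (b ⊗ₜ[k] c)) = μ (μ (a ⊗ₜ[k] b) ⊗ₜ[k] α c)
  comul_compat : TensorProduct.map α α ∘ₗ Δ = Δ ∘ₗ α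
  hom_coassoc : (TensorProduct.assoc k H H H).toLinearMap ∘ₗ TensorProduct.map Δ α ∘ₗ Δ
      = TensorProduct.map α Δ ∘ₗ Δ
  comul_mul : Δ ∘ₗ μ
      = TensorProduct.map μ μ ∘ₗ ttc k H H H H ∘ₗ TensorProduct.map Δ Δ

/-- Left module over a Hom-(bi)algebra. -/
structure IsHomModule (μ : H ⊗[k] H →ₗ[k] H) (α : H →ₗ[k] H)
    (ρ : H ⊗[k] M →ₗ[k] M) (αM : M →ₗ[k] M) : Prop where
  str_compat : ∀ (h : H) (m : M), αM (ρ (h ⊗ₜ[k] m)) = ρ (α h ⊗ₜ[k] αM m)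
  hom_smul : ∀ (h h' : H) (m : M),
      ρ (α h ⊗ₜ[k] ρ (h' ⊗ₜ[k] m)) = ρ (μ (h ⊗ₜ[k] h') ⊗ₜ[k] αM m)

/-- Left comodule over a Hom-(bi)algebra. -/
structure IsHomComodule (Δ : H →ₗ[k] H ⊗[k] H) (α : H →ₗ[k] H)
    (lM : M →ₗ[k] H ⊗[k] M) (αM : M →ₗ[k] M) : Prop where
  str_compat : TensorProduct.map α αM ∘ₗ lM = lM ∘ₗ αM
  hom_coact : TensorProduct.map Δ αM ∘ₗ lM
      = (TensorProduct.assoc k H H M).symm.toLinearMap ∘ₗ TensorProduct.map α lM ∘ₗ lM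

/-- `h ⊗ m ↦ (h₁·m)₍₋₁₎ β(h₂) ⊗ (h₁·m)₍₀₎`. -/
def ydL (μ : H ⊗[k] H →ₗ[k] H) (Δ : H →ₗ[k] H ⊗[k] H) (β : H →ₗ[k] H)
    (ρ : H ⊗[k] M →ₗ[k] M) (lM : M →ₗ[k] H ⊗[k] M) : H ⊗[k] M →ₗ[k] H ⊗[k] M :=
  TensorProduct.map μ LinearMap.id ∘ₗ rearr k H M H ∘ₗ
    TensorProduct.map (lM ∘ₗ ρ) β ∘ₗ rearr k H H M ∘ₗ
      TensorProduct.map Δ LinearMap.id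

/-- `h ⊗ m ↦ β(h₁) γ(m₍₋₁₎) ⊗ γ(h₂)·m₍₀₎`. -/
def ydR (μ : H ⊗[k] H →ₗ[k] H) (Δ : H →ₗ[k] H ⊗[k] H) (β γ : H →ₗ[k] H)
    (ρ : H ⊗[k] M →ₗ[k] M) (lM : M →ₗ[k] H ⊗[k] M) : H ⊗[k] M →ₗ[k] H ⊗[k] M :=
  TensorProduct.map (μ ∘ₗ TensorProduct.map β γ) (ρ ∘ₗ TensorProduct.map γ LinearMap.id) ∘ₗ
    ttc k H H H M ∘ₗ TensorProduct.map Δ lM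

/-- Yetter-Drinfeld module over a Hom-bialgebra: Hom-module, Hom-comodule and the
compatibility `(h₁·m)₍₋₁₎ α²(h₂) ⊗ (h₁·m)₍₀₎ = α²(h₁) α(m₍₋₁₎) ⊗ α(h₂)·m₍₀₎`. -/
def IsYetterDrinfeld (μ : H ⊗[k] H →ₗ[k] H) (Δ : H →ₗ[k] H ⊗[k] H) (α : H →ₗ[k] H)
    (ρ : H ⊗[k] M →ₗ[k] M) (lM : M →ₗ[k] H ⊗[k] M) (αM : M →ₗ[k] M) : Prop :=
  IsHomModule k μ α ρ αM ∧ IsHomComodule k Δ α lM αM ∧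
    ydL k μ Δ (α ∘ₗ α) ρ lM = ydR k μ Δ (α ∘ₗ α) α ρ lM

/-- `m ⊗ n ↦ αHinv(m₍₋₁₎)·n ⊗ m₍₀₎`. -/
def Bmap (αHinv : H →ₗ[k] H) (lM : M →ₗ[k] H ⊗[k] M) (ρN : H ⊗[k] N →ₗ[k] N) :
    M ⊗[k] N →ₗ[k] N ⊗[k] M :=
  TensorProduct.map (ρN ∘ₗ TensorProduct.map αHinv LinearMap.id) LinearMap.id ∘ₗ
    rearr k H M N ∘ₗ TensorProduct.map lM LinearMap.id

/-- Quasi-braiding `m ⊗ n ↦ αN⁻¹(αH⁻¹(m₍₋₁₎)·n) ⊗ αM⁻¹(m₍₀₎)`. -/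
def braidYD (αH : H ≃ₗ[k] H) (αM : M ≃ₗ[k] M) (αN : N ≃ₗ[k] N)
    (lM : M →ₗ[k] H ⊗[k] M) (ρN : H ⊗[k] N →ₗ[k] N) : M ⊗[k] N →ₗ[k] N ⊗[k] M :=
  TensorProduct.map
      (αN.symm.toLinearMap ∘ₗ ρN ∘ₗ TensorProduct.map αH.symm.toLinearMap LinearMap.id)
      αM.symm.toLinearMap ∘ₗ rearr k H M N ∘ₗ TensorProduct.map lM LinearMap.id

/-- Action on `M ⊗ N`: `h ⊗ (m ⊗ n) ↦ h₁·m ⊗ h₂·n`. -/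
def hatAction (Δ : H →ₗ[k] H ⊗[k] H)
    (ρM : H ⊗[k] M →ₗ[k] M) (ρN : H ⊗[k] N →ₗ[k] N) :
    H ⊗[k] (M ⊗[k] N) →ₗ[k] M ⊗[k] N :=
  TensorProduct.map ρM ρN ∘ₗ ttc k H H M N ∘ₗ TensorProduct.map Δ LinearMap.id

/-- Coaction on `M ⊗ N`: `m ⊗ n ↦ αHinv²(m₍₋₁₎ n₍₋₁₎) ⊗ (m₍₀₎ ⊗ n₍₀₎)`. -/
def hatCoaction (μ : H ⊗[k] H →ₗ[k] H) (αHinv : H →ₗ[k] H)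
    (lM : M →ₗ[k] H ⊗[k] M) (lN : N →ₗ[k] H ⊗[k] N) :
    M ⊗[k] N →ₗ[k] H ⊗[k] (M ⊗[k] N) :=
  TensorProduct.map (αHinv ∘ₗ αHinv ∘ₗ μ) LinearMap.id ∘ₗ ttc k H M H N ∘ₗ
    TensorProduct.map lM lN

/-- Action on `M ⊗ N`: `h ⊗ (m ⊗ n) ↦ αHinv²(h₁)·m ⊗ αHinv²(h₂)·n`. -/
def tildeAction (Δ : H →ₗ[k] H ⊗[k] H) (αHinv : H →ₗ[k] H)
    (ρM : H ⊗[k] M →ₗ[k] M) (ρN : H ⊗[k] N →ₗ[k] N) :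
    H ⊗[k] (M ⊗[k] N) →ₗ[k] M ⊗[k] N :=
  TensorProduct.map ρM ρN ∘ₗ ttc k H H M N ∘ₗ
    TensorProduct.map
      (TensorProduct.map (αHinv ∘ₗ αHinv) (αHinv ∘ₗ αHinv) ∘ₗ Δ) LinearMap.id

/-- Coaction on `M ⊗ N`: `m ⊗ n ↦ m₍₋₁₎ n₍₋₁₎ ⊗ (m₍₀₎ ⊗ n₍₀₎)`. -/
def tildeCoaction (μ : H ⊗[k] H →ₗ[k] H)
    (lM : M →ₗ[k] H ⊗[k] M) (lN : N →ₗ[k] H ⊗[k] N) :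
    M ⊗[k] N →ₗ[k] H ⊗[k] (M ⊗[k] N) :=
  TensorProduct.map μ LinearMap.id ∘ₗ ttc k H M H N ∘ₗ TensorProduct.map lM lN

/-- Associator `(x ⊗ y) ⊗ z ↦ αX⁻¹(x) ⊗ (y ⊗ αZ(z))`. -/
def aYD {X Z : Type*} [AddCommGroup X] [Module k X] [AddCommGroup Z] [Module k Z]
    (αX : X ≃ₗ[k] X) (Y : Type*) [AddCommGroup Y] [Module k Y] (αZ : Z ≃ₗ[k] Z) :
    (X ⊗[k] Y) ⊗[k] Z →ₗ[k] X ⊗[k] (Y ⊗[k] Z) :=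
  (TensorProduct.assoc k X Y Z).toLinearMap ∘ₗ
    TensorProduct.map (TensorProduct.map αX.symm.toLinearMap LinearMap.id) αZ.toLinearMap

/-- Inverse associator `x ⊗ (y ⊗ z) ↦ (αX(x) ⊗ y) ⊗ αZ⁻¹(z)`. -/
def aYDinv {X Z : Type*} [AddCommGroup X] [Module k X] [AddCommGroup Z] [Module k Z]
    (αX : X ≃ₗ[k] X) (Y : Type*) [AddCommGroup Y] [Module k Y] (αZ : Z ≃ₗ[k] Z) :
    X ⊗[k] (Y ⊗[k] Z) →ₗ[k] (X ⊗[k] Y) ⊗[k] Z :=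
  TensorProduct.map (TensorProduct.map αX.toLinearMap LinearMap.id) αZ.symm.toLinearMap ∘ₗ
    (TensorProduct.assoc k X Y Z).symm.toLinearMap

/-- Associator `(x ⊗ y) ⊗ z ↦ αX(x) ⊗ (y ⊗ αZ⁻¹(z))`. -/
def aTilde {X Z : Type*} [AddCommGroup X] [Module k X] [AddCommGroup Z] [Module k Z]
    (αX : X ≃ₗ[k] X) (Y : Type*) [AddCommGroup Y] [Module k Y] (αZ : Z ≃ₗ[k] Z) :
    (X ⊗[k] Y) ⊗[k] Z →ₗ[k] X ⊗[k] (Y ⊗[k] Z) :=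
  (TensorProduct.assoc k X Y Z).toLinearMap ∘ₗ
    TensorProduct.map (TensorProduct.map αX.toLinearMap LinearMap.id) αZ.symm.toLinearMap

/-- Inverse associator `x ⊗ (y ⊗ z) ↦ (αX⁻¹(x) ⊗ y) ⊗ αZ(z)`. -/
def aTildeInv {X Z : Type*} [AddCommGroup X] [Module k X] [AddCommGroup Z] [Module k Z]
    (αX : X ≃ₗ[k] X) (Y : Type*) [AddCommGroup Y] [Module k Y] (αZ : Z ≃ₗ[k] Z) :
    X ⊗[k] (Y ⊗[k] Z) →ₗ[k] (X ⊗[k] Y) ⊗[k] Z :=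
  TensorProduct.map (TensorProduct.map αX.symm.toLinearMap LinearMap.id) αZ.toLinearMap ∘ₗ
    (TensorProduct.assoc k X Y Z).symm.toLinearMap

/-- Quasitriangular Hom-bialgebra. -/
def IsQuasitriangular (μ : H ⊗[k] H →ₗ[k] H) (Δ : H →ₗ[k] H ⊗[k] H) (α : H →ₗ[k] H)
    (R : H ⊗[k] H) : Prop :=
  IsHomBialgebra k μ Δ α ∧
  TensorProduct.map Δ α R
    = TensorProduct.map (TensorProduct.map α α) μ (ttc k H H H H (R ⊗ₜ[k] R)) ∧
  TensorProduct.map α Δ R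
    = TensorProduct.map μ (TensorProduct.map α α ∘ₗ (TensorProduct.comm k H H).toLinearMap)
        (ttc k H H H H (R ⊗ₜ[k] R)) ∧
  ∀ h : H, TensorProduct.map μ μ (ttc k H H H H ((TensorProduct.comm k H H (Δ h)) ⊗ₜ[k] R))
      = TensorProduct.map μ μ (ttc k H H H H (R ⊗ₜ[k] Δ h))

/-- Coaction induced by an R-matrix: `m ↦ α(R²) ⊗ R¹·m`. -/
def coactionFromR (R : H ⊗[k] H) (α : H →ₗ[k] H) (ρM : H ⊗[k] M →ₗ[k] M) :
    M →ₗ[k] H ⊗[k] M :=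
  (TensorProduct.comm k M H).toLinearMap ∘ₗ TensorProduct.map ρM α ∘ₗ rearr k H H M ∘ₗ
    TensorProduct.mk k (H ⊗[k] H) M R

/-- Quasi-braiding from an R-matrix: `m ⊗ n ↦ αN⁻¹(R²·n) ⊗ αM⁻¹(R¹·m)`. -/
def braidR (R : H ⊗[k] H) (ρM : H ⊗[k] M →ₗ[k] M) (ρN : H ⊗[k] N →ₗ[k] N)
    (αM : M ≃ₗ[k] M) (αN : N ≃ₗ[k] N) : M ⊗[k] N →ₗ[k] N ⊗[k] M :=
  TensorProduct.map αN.symm.toLinearMap αM.symm.toLinearMap ∘ₗ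
    (TensorProduct.comm k M N).toLinearMap ∘ₗ TensorProduct.map ρM ρN ∘ₗ
      ttc k H H M N ∘ₗ TensorProduct.mk k (H ⊗[k] H) (M ⊗[k] N) R

/-- Coquasitriangular Hom-bialgebra. -/
def IsCoquasitriangular (μ : H ⊗[k] H →ₗ[k] H) (Δ : H →ₗ[k] H ⊗[k] H) (α : H →ₗ[k] H)
    (σ : H ⊗[k] H →ₗ[k] k) : Prop :=
  IsHomBialgebra k μ Δ α ∧
  (∀ x y z : H, σ (μ (x ⊗ₜ[k] y) ⊗ₜ[k] α z)
      = LinearMap.mul' k k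
          (TensorProduct.map σ σ (ttc k H H H H ((α x ⊗ₜ[k] α y) ⊗ₜ[k] Δ z)))) ∧
  (∀ x y z : H, σ (α x ⊗ₜ[k] μ (y ⊗ₜ[k] z))
      = LinearMap.mul' k k
          (TensorProduct.map σ σ (ttc k H H H H (Δ x ⊗ₜ[k] (α z ⊗ₜ[k] α y))))) ∧
  (∀ x y : H,
      (TensorProduct.rid k H)
        (TensorProduct.map (μ ∘ₗ (TensorProduct.comm k H H).toLinearMap) σ
          (ttc k H H H H (Δ x ⊗ₜ[k] Δ y)))
      = (TensorProduct.lid k H)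
          (TensorProduct.map σ μ (ttc k H H H H (Δ x ⊗ₜ[k] Δ y))))

/-- Action induced by a coquasitriangular form: `h ⊗ m ↦ σ(m₍₋₁₎ ⊗ α(h)) • m₍₀₎`. -/
def actionFromSigma (σ : H ⊗[k] H →ₗ[k] k) (α : H →ₗ[k] H)
    (lM : M →ₗ[k] H ⊗[k] M) : H ⊗[k] M →ₗ[k] M :=
  (TensorProduct.lid k M).toLinearMap ∘ₗ
    TensorProduct.map (σ ∘ₗ TensorProduct.map LinearMap.id α ∘ₗ
        (TensorProduct.comm k H H).toLinearMap) LinearMap.id ∘ₗ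
      (TensorProduct.assoc k H H M).symm.toLinearMap ∘ₗ
        TensorProduct.map LinearMap.id lM

/-- Quasi-braiding from a coquasitriangular form:
`m ⊗ n ↦ σ(n₍₋₁₎ ⊗ m₍₋₁₎) • (αN⁻¹(n₍₀₎) ⊗ αM⁻¹(m₍₀₎))`. -/
def braidSigma (σ : H ⊗[k] H →ₗ[k] k)
    (lM : M →ₗ[k] H ⊗[k] M) (lN : N →ₗ[k] H ⊗[k] N)
    (αM : M ≃ₗ[k] M) (αN : N ≃ₗ[k] N) : M ⊗[k] N →ₗ[k] N ⊗[k] M :=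
  (TensorProduct.lid k (N ⊗[k] M)).toLinearMap ∘ₗ
    TensorProduct.map (σ ∘ₗ (TensorProduct.comm k H H).toLinearMap)
      (TensorProduct.map αN.symm.toLinearMap αM.symm.toLinearMap ∘ₗ
        (TensorProduct.comm k M N).toLinearMap) ∘ₗ
      ttc k H M H N ∘ₗ TensorProduct.map lM lN


section TensorYetterDrinfeld

variable {k H M N : Type*} [Field k]
  [AddCommGroup H] [Module k H] [AddCommGroup M] [Module k M] [AddCommGroup N] [Module k N]

@[simp]
lemma rearr_tmul {A B C : Type*} [AddCommGroup A] [Module k A] [AddCommGroup B] [Module k B]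
    [AddCommGroup C] [Module k C] (a : A) (b : B) (c : C) :
    rearr k A B C ((a ⊗ₜ[k] b) ⊗ₜ[k] c) = (a ⊗ₜ[k] c) ⊗ₜ[k] b := by
  simp [rearr]

@[simp]
lemma ttc_tmul {A B C D : Type*} [AddCommGroup A] [Module k A] [AddCommGroup B] [Module k B]
    [AddCommGroup C] [Module k C] [AddCommGroup D] [Module k D] (a : A) (b : B) (c : C) (d : D) :
    ttc k A B C D ((a ⊗ₜ[k] b) ⊗ₜ[k] (c ⊗ₜ[k] d)) = (a ⊗ₜ[k] c) ⊗ₜ[k] (b ⊗ₜ[k] d) := by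
  simp [ttc]

/-- `(x ⊗ m) ⊗ (y ⊗ n) ↦ x y ⊗ (m ⊗ n)`. -/
def mulTensor (M N : Type*) [AddCommGroup M] [Module k M] [AddCommGroup N] [Module k N]
    (μ : H ⊗[k] H →ₗ[k] H) : (H ⊗[k] M) ⊗[k] (H ⊗[k] N) →ₗ[k] H ⊗[k] (M ⊗[k] N) :=
  TensorProduct.map μ LinearMap.id ∘ₗ ttc k H M H N

@[simp]
lemma mulTensor_tmul (μ : H ⊗[k] H →ₗ[k] H) (x y : H) (m : M) (n : N) :
    mulTensor M N μ ((x ⊗ₜ[k] m) ⊗ₜ[k] (y ⊗ₜ[k] n)) = μ (x ⊗ₜ[k] y) ⊗ₜ[k] (m ⊗ₜ[k] n) := by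
  simp [mulTensor]

/-- `(x ⊗ m) ⊗ y ↦ x y ⊗ m`. -/
def mulRight (M : Type*) [AddCommGroup M] [Module k M]
    (μ : H ⊗[k] H →ₗ[k] H) : (H ⊗[k] M) ⊗[k] H →ₗ[k] H ⊗[k] M :=
  TensorProduct.map μ LinearMap.id ∘ₗ rearr k H M H

@[simp]
lemma mulRight_tmul (μ : H ⊗[k] H →ₗ[k] H) (x y : H) (m : M) :
    mulRight M μ ((x ⊗ₜ[k] m) ⊗ₜ[k] y) = μ (x ⊗ₜ[k] y) ⊗ₜ[k] m := by
  simp [mulRight]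

/-- `(u ⊗ v) ⊗ (x ⊗ m) ↦ u α(x) ⊗ α⁻¹(v)·m`. -/
def diagAction (μ : H ⊗[k] H →ₗ[k] H) (α : H ≃ₗ[k] H) (ρ : H ⊗[k] M →ₗ[k] M) :
    (H ⊗[k] H) ⊗[k] (H ⊗[k] M) →ₗ[k] H ⊗[k] M :=
  TensorProduct.map (μ ∘ₗ TensorProduct.map LinearMap.id α.toLinearMap)
    (ρ ∘ₗ TensorProduct.map α.symm.toLinearMap LinearMap.id) ∘ₗ ttc k H H H M

@[simp]
lemma diagAction_tmul (μ : H ⊗[k] H →ₗ[k] H) (α : H ≃ₗ[k] H) (ρ : H ⊗[k] M →ₗ[k] M)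
    (u v x : H) (m : M) :
    diagAction μ α ρ ((u ⊗ₜ[k] v) ⊗ₜ[k] (x ⊗ₜ[k] m))
      = μ (u ⊗ₜ[k] α x) ⊗ₜ[k] ρ (α.symm v ⊗ₜ[k] m) := by
  simp [diagAction]

/-- `x ↦ λ(α⁻²(x)·m)`. -/
def coactSmul (α : H ≃ₗ[k] H) (ρ : H ⊗[k] M →ₗ[k] M) (lM : M →ₗ[k] H ⊗[k] M) (m : M) :
    H →ₗ[k] H ⊗[k] M :=
  lM ∘ₗ ρ ∘ₗ (TensorProduct.mk k H M).flip m ∘ₗ α.symm.toLinearMap ∘ₗ α.symm.toLinearMap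

@[simp]
lemma coactSmul_apply (α : H ≃ₗ[k] H) (ρ : H ⊗[k] M →ₗ[k] M) (lM : M →ₗ[k] H ⊗[k] M)
    (m : M) (x : H) :
    coactSmul α ρ lM m x = lM (ρ (α.symm (α.symm x) ⊗ₜ[k] m)) := by
  simp [coactSmul]

variable {μ : H ⊗[k] H →ₗ[k] H} {Δ : H →ₗ[k] H ⊗[k] H} {α : H ≃ₗ[k] H}

lemma IsHomBialgebra.mul_mulTensor (hH : IsHomBialgebra k μ Δ α.toLinearMap)
    (p : H ⊗[k] M) (q : H ⊗[k] N) (z : H) :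
    mulRight (M ⊗[k] N) μ (mulTensor M N μ (p ⊗ₜ[k] q) ⊗ₜ[k] α z)
      = mulTensor M N μ
          (TensorProduct.map α.toLinearMap LinearMap.id p ⊗ₜ[k] mulRight N μ (q ⊗ₜ[k] z)) := by
  have ha := hH.hom_assoc
  simp only [LinearEquiv.coe_coe] at ha
  induction p using TensorProduct.induction_on with
  | zero => simp
  | add p p' hp hp' => simp only [add_tmul, map_add, hp, hp']
  | tmul x m =>
    induction q using TensorProduct.induction_on with
    | zero => simp
    | add q q' hq hq' => simp only [add_tmul, tmul_add, map_add, hq, hq']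
    | tmul y n => simp [ha]

lemma IsHomBialgebra.mulTensor_mul (hH : IsHomBialgebra k μ Δ α.toLinearMap)
    (p : H ⊗[k] M) (x y : H) (n : N) :
    mulTensor M N μ
        (TensorProduct.map α.toLinearMap LinearMap.id p ⊗ₜ[k] (μ (x ⊗ₜ[k] y) ⊗ₜ[k] n))
      = mulTensor M N μ (mulRight M μ (p ⊗ₜ[k] x) ⊗ₜ[k] (α y ⊗ₜ[k] n)) := by
  have ha := hH.hom_assoc
  simp only [LinearEquiv.coe_coe] at ha
  induction p using TensorProduct.induction_on with
  | zero => simp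
  | add p p' hp hp' => simp only [add_tmul, map_add, hp, hp']
  | tmul z m => simp [ha]

lemma IsHomBialgebra.comul_apply (hH : IsHomBialgebra k μ Δ α.toLinearMap) (h : H) :
    Δ (α h) = TensorProduct.map α.toLinearMap α.toLinearMap (Δ h) := by
  simpa using (LinearMap.congr_fun hH.comul_compat h).symm

lemma IsHomBialgebra.comul_symm_apply (hH : IsHomBialgebra k μ Δ α.toLinearMap) (h : H) :
    Δ (α.symm h) = TensorProduct.map α.symm.toLinearMap α.symm.toLinearMap (Δ h) := by
  obtain ⟨h, rfl⟩ := α.surjective h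
  rw [hH.comul_apply, α.symm_apply_apply, ← LinearMap.comp_apply, ← TensorProduct.map_comp]
  simp

lemma IsHomBialgebra.coassoc_apply (hH : IsHomBialgebra k μ Δ α.toLinearMap) (h : H) :
    TensorProduct.map Δ α.toLinearMap (Δ h)
      = (TensorProduct.assoc k H H H).symm (TensorProduct.map α.toLinearMap Δ (Δ h)) := by
  rw [LinearEquiv.eq_symm_apply]
  exact LinearMap.congr_fun hH.hom_coassoc h

lemma IsYetterDrinfeld.mulRight_coactSmul (hH : IsHomBialgebra k μ Δ α.toLinearMap)
    {ρ : H ⊗[k] M →ₗ[k] M} {lM : M →ₗ[k] H ⊗[k] M} {αM : M →ₗ[k] M}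
    (hM : IsYetterDrinfeld k μ Δ α.toLinearMap ρ lM αM) (m : M) (w : H) :
    mulRight M μ (TensorProduct.map (coactSmul α ρ lM m) LinearMap.id (Δ w))
      = diagAction μ α ρ (Δ w ⊗ₜ[k] lM m) := by
  have h := LinearMap.congr_fun hM.2.2 (α.symm (α.symm w) ⊗ₜ[k] m)
  simp only [ydL, ydR, LinearMap.comp_apply, TensorProduct.map_tmul, hH.comul_symm_apply,
    LinearMap.id_apply] at h
  convert h using 1
  · generalize Δ w = t
    induction t using TensorProduct.induction_on with
    | zero => simp
    | add t t' ht ht' => simp only [add_tmul, map_add, ht, ht']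
    | tmul x y => simp [mulRight]
  · generalize Δ w = t
    generalize lM m = p
    induction t using TensorProduct.induction_on with
    | zero => simp
    | add t t' ht ht' => simp only [add_tmul, map_add, ht, ht']
    | tmul x y =>
      induction p using TensorProduct.induction_on with
      | zero => simp
      | add p p' hp hp' => simp only [tmul_add, map_add, hp, hp']
      | tmul z m => simp

lemma tildeAction_tmul (ρM : H ⊗[k] M →ₗ[k] M) (ρN : H ⊗[k] N →ₗ[k] N) (h : H) (t : M ⊗[k] N) :
    tildeAction k Δ α.symm.toLinearMap ρM ρN (h ⊗ₜ[k] t)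
      = TensorProduct.map ρM ρN (ttc k H H M N
          (TensorProduct.map (α.symm.toLinearMap ∘ₗ α.symm.toLinearMap)
            (α.symm.toLinearMap ∘ₗ α.symm.toLinearMap) (Δ h) ⊗ₜ[k] t)) := by
  simp [tildeAction]

lemma tildeCoaction_tmul (lM : M →ₗ[k] H ⊗[k] M) (lN : N →ₗ[k] H ⊗[k] N) (m : M) (n : N) :
    tildeCoaction k μ lM lN (m ⊗ₜ[k] n) = mulTensor M N μ (lM m ⊗ₜ[k] lN n) := by
  simp [tildeCoaction, mulTensor]

lemma tildeCoaction_tildeAction (ρM : H ⊗[k] M →ₗ[k] M) (lM : M →ₗ[k] H ⊗[k] M)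
    (ρN : H ⊗[k] N →ₗ[k] N) (lN : N →ₗ[k] H ⊗[k] N) (h : H) (m : M) (n : N) :
    tildeCoaction k μ lM lN (tildeAction k Δ α.symm.toLinearMap ρM ρN (h ⊗ₜ[k] (m ⊗ₜ[k] n)))
      = mulTensor M N μ
          (TensorProduct.map (coactSmul α ρM lM m) (coactSmul α ρN lN n) (Δ h)) := by
  rw [tildeAction_tmul]
  generalize Δ h = t
  induction t using TensorProduct.induction_on with
  | zero => simp
  | add t t' ht ht' => simp only [add_tmul, map_add, ht, ht']
  | tmul x y => simp [tildeCoaction_tmul]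

lemma isHomModule_tildeAction (hH : IsHomBialgebra k μ Δ α.toLinearMap)
    {ρM : H ⊗[k] M →ₗ[k] M} {αM : M →ₗ[k] M} (hM : IsHomModule k μ α.toLinearMap ρM αM)
    {ρN : H ⊗[k] N →ₗ[k] N} {αN : N →ₗ[k] N} (hN : IsHomModule k μ α.toLinearMap ρN αN) :
    IsHomModule k μ α.toLinearMap (tildeAction k Δ α.symm.toLinearMap ρM ρN)
      (TensorProduct.map αM αN) where
  str_compat h t := by
    have eM := hM.str_compat
    have eN := hN.str_compat
    simp only [LinearEquiv.coe_coe] at eM eN ⊢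
    rw [tildeAction_tmul, tildeAction_tmul, hH.comul_apply]
    generalize Δ h = d
    induction d using TensorProduct.induction_on with
    | zero => simp
    | add d d' hd hd' => simp only [add_tmul, map_add, hd, hd']
    | tmul x y =>
      induction t using TensorProduct.induction_on with
      | zero => simp
      | add t t' ht ht' => simp only [tmul_add, map_add, ht, ht']
      | tmul m n => simp [eM, eN]
  hom_smul h h' t := by
    have eM := hM.hom_smul
    have eN := hN.hom_smul
    have em : ∀ a b, α.symm (μ (a ⊗ₜ[k] b)) = μ (α.symm a ⊗ₜ[k] α.symm b) := fun a b => by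
      rw [LinearEquiv.symm_apply_eq]
      simpa using (hH.mul_mult (α.symm a) (α.symm b)).symm
    have ec := LinearMap.congr_fun hH.comul_mul (h ⊗ₜ[k] h')
    simp only [LinearMap.comp_apply, TensorProduct.map_tmul] at ec
    simp only [LinearEquiv.coe_coe] at eM eN ⊢
    rw [tildeAction_tmul, tildeAction_tmul, tildeAction_tmul, hH.comul_apply, ec]
    generalize Δ h = d
    generalize Δ h' = d'
    induction d using TensorProduct.induction_on with
    | zero => simp
    | add d e hd he => simp only [add_tmul, map_add, hd, he]
    | tmul x y =>
      induction d' using TensorProduct.induction_on with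
      | zero => simp
      | add d e hd he => simp only [add_tmul, tmul_add, map_add, hd, he]
      | tmul x' y' =>
        induction t using TensorProduct.induction_on with
        | zero => simp
        | add t t' ht ht' => simp only [tmul_add, map_add, ht, ht']
        | tmul m n =>
          have eM' := eM (α.symm (α.symm x)) (α.symm (α.symm x')) m
          have eN' := eN (α.symm (α.symm y)) (α.symm (α.symm y')) n
          simp only [LinearEquiv.apply_symm_apply] at eM' eN'
          simp [em, eM', eN']

lemma isHomComodule_tildeCoaction (hH : IsHomBialgebra k μ Δ α.toLinearMap)
    {lM : M →ₗ[k] H ⊗[k] M} {αM : M →ₗ[k] M} (hM : IsHomComodule k Δ α.toLinearMap lM αM)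
    {lN : N →ₗ[k] H ⊗[k] N} {αN : N →ₗ[k] N} (hN : IsHomComodule k Δ α.toLinearMap lN αN) :
    IsHomComodule k Δ α.toLinearMap (tildeCoaction k μ lM lN) (TensorProduct.map αM αN) where
  str_compat := by
    refine TensorProduct.ext' fun m n => ?_
    have eM := LinearMap.congr_fun hM.str_compat m
    have eN := LinearMap.congr_fun hN.str_compat n
    have em := hH.mul_mult
    simp only [LinearMap.comp_apply, LinearEquiv.coe_coe] at eM eN em
    simp only [LinearMap.comp_apply, TensorProduct.map_tmul, tildeCoaction_tmul, ← eM, ← eN]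
    generalize lM m = p
    generalize lN n = q
    induction p using TensorProduct.induction_on with
    | zero => simp
    | add p p' hp hp' => simp only [add_tmul, map_add, hp, hp']
    | tmul x m =>
      induction q using TensorProduct.induction_on with
      | zero => simp
      | add q q' hq hq' => simp only [tmul_add, map_add, hq, hq']
      | tmul y n => simp [em]
  hom_coact := by
    refine TensorProduct.ext' fun m n => ?_
    have eM := LinearMap.congr_fun hM.hom_coact m
    have eN := LinearMap.congr_fun hN.hom_coact n
    have em := hH.mul_mult
    have ec := LinearMap.congr_fun hH.comul_mul
    simp only [LinearMap.comp_apply, LinearEquiv.coe_coe] at eM eN em ec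
    let Ψ : ((H ⊗[k] H) ⊗[k] M) ⊗[k] ((H ⊗[k] H) ⊗[k] N) →ₗ[k] (H ⊗[k] H) ⊗[k] (M ⊗[k] N) :=
      TensorProduct.map (TensorProduct.map μ μ ∘ₗ ttc k H H H H) LinearMap.id ∘ₗ
        ttc k (H ⊗[k] H) M (H ⊗[k] H) N
    trans Ψ (TensorProduct.map Δ αM (lM m) ⊗ₜ[k] TensorProduct.map Δ αN (lN n))
    · simp only [LinearMap.comp_apply, tildeCoaction_tmul]
      generalize lM m = p
      generalize lN n = q
      induction p using TensorProduct.induction_on with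
      | zero => simp
      | add p p' hp hp' => simp only [add_tmul, map_add, hp, hp']
      | tmul x m =>
        induction q using TensorProduct.induction_on with
        | zero => simp
        | add q q' hq hq' => simp only [tmul_add, map_add, hq, hq']
        | tmul y n => simp [Ψ, ec]
    · rw [eM, eN]
      simp only [LinearMap.comp_apply, tildeCoaction_tmul, LinearEquiv.coe_coe]
      generalize lM m = p
      generalize lN n = q
      induction p using TensorProduct.induction_on with
      | zero => simp
      | add p p' hp hp' => simp only [add_tmul, map_add, hp, hp']
      | tmul x m =>
        induction q using TensorProduct.induction_on with
        | zero => simp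
        | add q q' hq hq' => simp only [tmul_add, map_add, hq, hq']
        | tmul y n =>
          simp only [TensorProduct.map_tmul, mulTensor_tmul, LinearEquiv.coe_coe, em,
            tildeCoaction_tmul]
          generalize lM m = p
          generalize lN n = q
          induction p using TensorProduct.induction_on with
          | zero => simp
          | add p p' hp hp' => simp only [add_tmul, tmul_add, map_add, hp, hp']
          | tmul x' m =>
            induction q using TensorProduct.induction_on with
            | zero => simp
            | add q q' hq hq' => simp only [tmul_add, map_add, hq, hq']
            | tmul y' n => simp [Ψ]

lemma ydL_tilde_eq_ydR_tilde (hH : IsHomBialgebra k μ Δ α.toLinearMap)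
    {ρM : H ⊗[k] M →ₗ[k] M} {lM : M →ₗ[k] H ⊗[k] M} {αM : M →ₗ[k] M}
    (hM : IsYetterDrinfeld k μ Δ α.toLinearMap ρM lM αM)
    {ρN : H ⊗[k] N →ₗ[k] N} {lN : N →ₗ[k] H ⊗[k] N} {αN : N →ₗ[k] N}
    (hN : IsYetterDrinfeld k μ Δ α.toLinearMap ρN lN αN) :
    ydL k μ Δ (α.toLinearMap ∘ₗ α.toLinearMap) (tildeAction k Δ α.symm.toLinearMap ρM ρN)
        (tildeCoaction k μ lM lN)
      = ydR k μ Δ (α.toLinearMap ∘ₗ α.toLinearMap) α.toLinearMap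
          (tildeAction k Δ α.symm.toLinearMap ρM ρN) (tildeCoaction k μ lM lN) := by
  refine TensorProduct.ext' fun h t => ?_
  induction t using TensorProduct.induction_on with
  | zero => simp
  | add t t' ht ht' => simp only [tmul_add, map_add, ht, ht']
  | tmul m n =>
  let X := coactSmul α ρM lM m
  let Y := coactSmul α ρN lN n
  let Φ₁ : (H ⊗[k] H) ⊗[k] H →ₗ[k] H ⊗[k] (M ⊗[k] N) :=
    mulRight (M ⊗[k] N) μ ∘ₗ
      TensorProduct.map (mulTensor M N μ ∘ₗ TensorProduct.map X Y) α.toLinearMap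
  -- `v ⊗ (y ⊗ n) ↦ α²(y) ⊗ α⁻¹(v)·n`
  let G : H ⊗[k] (H ⊗[k] N) →ₗ[k] H ⊗[k] N :=
    TensorProduct.map (α.toLinearMap ∘ₗ α.toLinearMap)
      (ρN ∘ₗ TensorProduct.map α.symm.toLinearMap LinearMap.id) ∘ₗ
        (TensorProduct.leftComm k H H N).toLinearMap
  let Gn : H →ₗ[k] H ⊗[k] N := G ∘ₗ (TensorProduct.mk k H (H ⊗[k] N)).flip (lN n)
  let Φ₂ : (H ⊗[k] H) ⊗[k] H →ₗ[k] H ⊗[k] (M ⊗[k] N) :=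
    mulTensor M N μ ∘ₗ TensorProduct.map (mulRight M μ ∘ₗ TensorProduct.map X LinearMap.id) Gn
  let Φ₃ : (H ⊗[k] H) ⊗[k] H →ₗ[k] H ⊗[k] (M ⊗[k] N) :=
    mulTensor M N μ ∘ₗ TensorProduct.map
      (diagAction μ α ρM ∘ₗ (TensorProduct.mk k _ (H ⊗[k] M)).flip (lM m)) Gn
  calc
    _ = Φ₁ (TensorProduct.map Δ α.toLinearMap (Δ h)) := by
      simp only [ydL, LinearMap.comp_apply, TensorProduct.map_tmul, LinearMap.id_apply]
      generalize Δ h = t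
      induction t using TensorProduct.induction_on with
      | zero => simp
      | add t t' ht ht' => simp only [add_tmul, map_add, ht, ht']
      | tmul x y => simp [Φ₁, mulRight, tildeCoaction_tildeAction, X, Y]
    _ = Φ₂ ((TensorProduct.assoc k H H H).symm (TensorProduct.map α.toLinearMap Δ (Δ h))) := by
      rw [hH.coassoc_apply]
      generalize Δ h = t
      induction t using TensorProduct.induction_on with
      | zero => simp
      | add t t' ht ht' => simp only [map_add, ht, ht']
      | tmul x w =>
        trans mulTensor M N μ (TensorProduct.map α.toLinearMap LinearMap.id (X (α x)) ⊗ₜ[k]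
          mulRight N μ (TensorProduct.map Y LinearMap.id (Δ w)))
        · rw [TensorProduct.map_tmul]
          generalize Δ w = d
          induction d using TensorProduct.induction_on with
          | zero => simp
          | add d d' hd hd' => simp only [tmul_add, map_add, hd, hd']
          | tmul u v => simp [Φ₁, hH.mul_mulTensor]
        · rw [hN.mulRight_coactSmul hH, TensorProduct.map_tmul]
          generalize Δ w = d
          induction d using TensorProduct.induction_on with
          | zero => simp
          | add d d' hd hd' => simp only [tmul_add, add_tmul, map_add, hd, hd']
          | tmul u v =>
            simp only [Φ₂, Gn, LinearMap.comp_apply, TensorProduct.assoc_symm_tmul,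
              TensorProduct.map_tmul, LinearMap.flip_apply, TensorProduct.mk_apply]
            generalize lN n = q
            induction q using TensorProduct.induction_on with
            | zero => simp
            | add q q' hq hq' => simp only [tmul_add, map_add, hq, hq']
            | tmul y n => simp [G, hH.mulTensor_mul]
    _ = Φ₃ ((TensorProduct.assoc k H H H).symm (TensorProduct.map α.toLinearMap Δ (Δ h))) := by
      rw [← hH.coassoc_apply]
      generalize Δ h = t
      induction t using TensorProduct.induction_on with
      | zero => simp
      | add t t' ht ht' => simp only [map_add, ht, ht']
      | tmul w z => simp [Φ₂, Φ₃, X, hM.mulRight_coactSmul hH]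
    _ = _ := by
      have em := hH.mul_mult
      have ea := hH.hom_assoc
      simp only [LinearEquiv.coe_coe] at em ea
      simp only [ydR, LinearMap.comp_apply, TensorProduct.map_tmul, tildeCoaction_tmul]
      simp only [Φ₃, Gn]
      generalize Δ h = t
      generalize lM m = p
      generalize lN n = q
      induction t using TensorProduct.induction_on with
      | zero => simp
      | add t t' ht ht' => simp only [add_tmul, map_add, ht, ht']
      | tmul x w =>
        induction p using TensorProduct.induction_on with
        | zero => simp
        | add p p' hp hp' =>
          simp only [add_tmul, tmul_add, map_add, LinearMap.comp_add,
            TensorProduct.map_add_left, LinearMap.add_apply, hp, hp']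
        | tmul y m =>
          induction q using TensorProduct.induction_on with
          | zero => simp
          | add q q' hq hq' =>
            simp only [tmul_add, map_add, LinearMap.comp_add,
              TensorProduct.map_add_right, LinearMap.add_apply, hq, hq']
          | tmul z n =>
            simp only [TensorProduct.map_tmul, mulTensor_tmul, ttc_tmul, LinearMap.comp_apply,
              LinearEquiv.coe_coe, tildeAction_tmul, hH.comul_apply, LinearMap.id_apply]
            generalize Δ w = d
            induction d using TensorProduct.induction_on with
            | zero => simp
            | add d d' hd hd' => simp only [tmul_add, add_tmul, map_add, hd, hd']
            | tmul u v => simp [G, em, ea]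

end TensorYetterDrinfeld

/-- the tensor product `M ⊗̃ N` of two Yetter-Drinfeld modules, with action
`h·(m⊗n) = αH⁻²(h₁)·m ⊗ αH⁻²(h₂)·n` and coaction `m⊗n ↦ m₍₋₁₎n₍₋₁₎ ⊗ (m₍₀₎ ⊗ n₍₀₎)`,
is again a Yetter-Drinfeld module. -/
theorem stmt14 {k H M N : Type*} [Field k]
    [AddCommGroup H] [Module k H] [AddCommGroup M] [Module k M] [AddCommGroup N] [Module k N]
    (μ : H ⊗[k] H →ₗ[k] H) (Δ : H →ₗ[k] H ⊗[k] H) (αH : H ≃ₗ[k] H)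
    (hH : IsHomBialgebra k μ Δ αH.toLinearMap)
    (ρM : H ⊗[k] M →ₗ[k] M) (lM : M →ₗ[k] H ⊗[k] M) (αM : M →ₗ[k] M)
    (hM : IsYetterDrinfeld k μ Δ αH.toLinearMap ρM lM αM)
    (ρN : H ⊗[k] N →ₗ[k] N) (lN : N →ₗ[k] H ⊗[k] N) (αN : N →ₗ[k] N)
    (hN : IsYetterDrinfeld k μ Δ αH.toLinearMap ρN lN αN) :
    IsYetterDrinfeld k μ Δ αH.toLinearMap (tildeAction k Δ αH.symm.toLinearMap ρM ρN)
      (tildeCoaction k μ lM lN) (TensorProduct.map αM αN) := by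
  exact ⟨isHomModule_tildeAction hH hM.1 hN.1, isHomComodule_tildeCoaction hH hM.2.1 hN.2.1,
    ydL_tilde_eq_ydR_tilde hH hM hN⟩

end HomYD
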